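/- arXiv:1107.1119 — 5 statements merged into one kernel-verified Lean document; each statement's English description precedes it below -/
import Mathlib

section
/- Let S be a set, n a natural number, and let ⊞ : S × ℝⁿ → S and ⊟ : S × S → ℝⁿ be operations satisfying: (a) x ⊞ 0 = x for all x ∈ S; (b) x ⊞ (y ⊟ x) = y for all x, y ∈ S; (d) ‖(x ⊞ δ₁) ⊟ (x ⊞ δ₂)‖ ≤ ‖δ₁ − δ₂‖ for all x ∈ S and δ₁, δ₂ ∈ ℝⁿ. Then d(x, y) := ‖y ⊟ x‖ defines a metric on S, i.e. d(x,y) = 0 iff x = y, d(x,y) = d(y,x), and d(x,z) ≤ d(x,y) + d(y,z) for all x, y, z ∈ S. -/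
/-- If `⊞ : S × ℝⁿ → S` and `⊟ : S × S → ℝⁿ` satisfy axioms
(a) `x ⊞ 0 = x`, (b) `x ⊞ (y ⊟ x) = y`, and (d) the Lipschitz axiom,
then `d(x, y) := ‖y ⊟ x‖` is a metric on `S`. -/
theorem boxminus_induces_metric
    {S : Type*} {n : ℕ}
    (bplus : S → EuclideanSpace ℝ (Fin n) → S)
    (bminus : S → S → EuclideanSpace ℝ (Fin n))
    (ax_zero : ∀ x : S, bplus x 0 = x)
    (ax_surj : ∀ x y : S, bplus x (bminus y x) = y)
    (ax_lipschitz : ∀ (x : S) (δ₁ δ₂ : EuclideanSpace ℝ (Fin n)),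
      ‖bminus (bplus x δ₁) (bplus x δ₂)‖ ≤ ‖δ₁ - δ₂‖) :
    (∀ x y : S, ‖bminus y x‖ = 0 ↔ x = y) ∧
    (∀ x y : S, ‖bminus y x‖ = ‖bminus x y‖) ∧
    (∀ x y z : S, ‖bminus z x‖ ≤ ‖bminus y x‖ + ‖bminus z y‖) := by
  have le_swap (x y : S) : ‖bminus x y‖ ≤ ‖bminus y x‖ := by
    simpa [ax_zero, ax_surj] using ax_lipschitz x 0 (bminus y x)
  have symm (x y : S) : ‖bminus y x‖ = ‖bminus x y‖ := le_antisymm (le_swap y x) (le_swap x y)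
  refine ⟨fun x y => ⟨fun h => ?_, ?_⟩, symm, fun x y z => ?_⟩
  · rw [← ax_surj x y, norm_eq_zero.mp h, ax_zero]
  · rintro rfl
    simpa [ax_zero] using ax_lipschitz x 0 0
  · calc ‖bminus z x‖ ≤ ‖bminus z y - bminus x y‖ := by
          simpa only [ax_surj] using ax_lipschitz y (bminus z y) (bminus x y)
      _ ≤ ‖bminus z y‖ + ‖bminus x y‖ := norm_sub_le _ _
      _ = ‖bminus y x‖ + ‖bminus z y‖ := by rw [symm x y, add_comm]
end

section
/- Let S be a set, n a natural number, and let ⊞ : S × ℝⁿ → S and ⊟ : S × S → ℝⁿ satisfy axioms (a) x ⊞ 0 = x, (b) x ⊞ (y ⊟ x) = y, and (d) ‖(x ⊞ δ₁) ⊟ (x ⊞ δ₂)‖ ≤ ‖δ₁ − δ₂‖. Let (Ω, P) be a probability space and X : Ω → S a map such that for every μ' ∈ S the function ω ↦ X(ω) ⊟ μ' is measurable and square-integrable. If μ ∈ S minimizes the expected squared distance, i.e. E‖X ⊟ μ‖² ≤ E‖X ⊟ μ'‖² for all μ' ∈ S, then E(X ⊟ μ) = 0 (the ℝⁿ-valued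 expectation of ω ↦ X(ω) ⊟ μ vanishes). -/
open MeasureTheory

/-- The expected squared distance from a square-integrable random vector to its mean. -/
theorem integral_norm_sub_integral_sq {E Ω : Type*} [NormedAddCommGroup E]
    [InnerProductSpace ℝ E] [CompleteSpace E] [MeasurableSpace Ω] (P : Measure Ω)
    [IsProbabilityMeasure P] {f : Ω → E} (hf : MemLp f 2 P) :
    ∫ ω, ‖f ω - ∫ ω', f ω' ∂P‖ ^ 2 ∂P = ∫ ω, ‖f ω‖ ^ 2 ∂P - ‖∫ ω, f ω ∂P‖ ^ 2 := by
  set c := ∫ ω, f ω ∂P with hc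
  have hfi : Integrable f P := hf.integrable one_le_two
  have hsq : Integrable (fun ω => ‖f ω‖ ^ 2) P := hf.integrable_norm_pow two_ne_zero
  have hinner : Integrable (fun ω => 2 * inner ℝ c (f ω)) P := (hfi.const_inner c).const_mul 2
  have hdiff : Integrable (fun ω => ‖f ω‖ ^ 2 - 2 * inner ℝ c (f ω)) P := hsq.sub hinner
  have hexpand : ∀ ω, ‖f ω - c‖ ^ 2 = ‖f ω‖ ^ 2 - 2 * inner ℝ c (f ω) + ‖c‖ ^ 2 := fun ω => by
    rw [norm_sub_sq_real, real_inner_comm]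
  simp_rw [hexpand]
  rw [integral_add hdiff (integrable_const _), integral_sub hsq hinner,
    integral_const_mul, integral_inner hfi, ← hc, real_inner_self_eq_norm_sq]
  simp only [integral_const, probReal_univ, one_smul]
  ring

/-- On a ⊞-manifold, if `μ` minimizes the expected squared
⊟-distance to a random variable `X`, then `E(X ⊟ μ) = 0`. -/
theorem expected_value_implicit_characterization
    {S : Type*} {n : ℕ}
    (bplus : S → EuclideanSpace ℝ (Fin n) → S)
    (bminus : S → S → EuclideanSpace ℝ (Fin n))
    (ax_zero : ∀ x : S, bplus x 0 = x)
    (ax_surj : ∀ x y : S, bplus x (bminus y x) = y)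
    (ax_lipschitz : ∀ (x : S) (δ₁ δ₂ : EuclideanSpace ℝ (Fin n)),
      ‖bminus (bplus x δ₁) (bplus x δ₂)‖ ≤ ‖δ₁ - δ₂‖)
    {Ω : Type*} [MeasurableSpace Ω] (P : Measure Ω) [IsProbabilityMeasure P]
    (X : Ω → S)
    (hmeas : ∀ μ' : S, Measurable (fun ω => bminus (X ω) μ'))
    (hsq : ∀ μ' : S, Integrable (fun ω => ‖bminus (X ω) μ'‖ ^ 2) P)
    (μ : S)
    (hmin : ∀ μ' : S,
      ∫ ω, ‖bminus (X ω) μ‖ ^ 2 ∂P ≤ ∫ ω, ‖bminus (X ω) μ'‖ ^ 2 ∂P) :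
    ∫ ω, bminus (X ω) μ ∂P = 0 := by
  set c := ∫ ω, bminus (X ω) μ ∂P with hc
  have hf : MemLp (fun ω => bminus (X ω) μ) 2 P :=
    (memLp_two_iff_integrable_sq_norm (hmeas μ).aestronglyMeasurable).2 (hsq μ)
  have hle : ∀ ω, ‖bminus (X ω) (bplus μ c)‖ ^ 2 ≤ ‖bminus (X ω) μ - c‖ ^ 2 := fun ω => by
    have h := ax_lipschitz μ (bminus (X ω) μ) c
    rw [ax_surj] at h
    gcongr
  have hmono := integral_mono (hsq (bplus μ c))
    ((hf.sub (memLp_const c)).integrable_norm_pow two_ne_zero) hle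
  have hvar := integral_norm_sub_integral_sq P hf
  rw [← hc] at hvar
  have hmin' := hmin (bplus μ c)
  simp only [Pi.sub_apply] at hmono
  have hc_sq : ‖c‖ ^ 2 ≤ 0 := by linarith
  exact norm_eq_zero.1 (pow_eq_zero_iff two_ne_zero |>.1 (le_antisymm hc_sq (sq_nonneg _)))
end

section
/- For all real numbers α, β ≥ 0 and all γ ∈ ℝ, the distance on a sphere is less than or equal to the Euclidean distance in the tangential plane; formally: arccos(cos α · cos β + sin α · sin β · cos γ) ≤ √(α² + β² − 2·α·β·cos γ). -/
/-- On `[0, π]` the function `sin x / x` is antitone (stated without division). -/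
theorem mul_sin_le_mul_sin {a b : ℝ} (ha : 0 ≤ a) (hab : a ≤ b) (hb : b ≤ Real.pi) :
    a * Real.sin b ≤ b * Real.sin a := by
  rcases ha.eq_or_lt with rfl | ha'
  · simp
  have hb' : 0 < b := ha'.trans_le hab
  have h₀ : (0 : ℝ) ∈ Set.Icc 0 Real.pi := ⟨le_rfl, Real.pi_pos.le⟩
  have h₁ : b ∈ Set.Icc 0 Real.pi := ⟨hb'.le, hb⟩
  have hw : 0 ≤ 1 - a / b := by rw [sub_nonneg, div_le_one hb']; exact hab
  have h := strictConcaveOn_sin_Icc.concaveOn.2 h₀ h₁ hw (div_nonneg ha hb'.le) (by ring)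
  simp only [smul_eq_mul, Real.sin_zero, mul_zero, zero_add, div_mul_cancel₀ _ hb'.ne'] at h
  rwa [div_mul_eq_mul_div, div_le_iff₀ hb', mul_comm (Real.sin a)] at h

/-- The graph of `cos √s` lies above its tangent at `s = d ^ 2`, for `d ∈ [0, π]`. -/
theorem exists_cos_sub_mul_le_cos {d : ℝ} (hd : 0 ≤ d) (hdpi : d ≤ Real.pi) :
    ∃ k : ℝ, ∀ x : ℝ, Real.cos d - k * (x ^ 2 - d ^ 2) ≤ Real.cos x := by
  rcases hd.eq_or_lt with rfl | hd'
  · refine ⟨1 / 2, fun x => ?_⟩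
    have := Real.one_sub_sq_div_two_le_cos (x := x)
    rw [Real.cos_zero]
    linarith
  set m := Real.sin d / d with hm
  have hm0 : 0 ≤ m := div_nonneg (Real.sin_nonneg_of_nonneg_of_le_pi hd hdpi) hd
  have hderiv (x : ℝ) : HasDerivAt (fun x => Real.cos x + m / 2 * x ^ 2)
      (-Real.sin x + m * x) x := by
    refine ((Real.hasDerivAt_cos x).add
      ((hasDerivAt_pow 2 x).const_mul (m / 2))).congr_deriv ?_
    push_cast
    ring
  have hcont : Continuous (fun x => Real.cos x + m / 2 * x ^ 2) := by fun_prop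
  have hanti : AntitoneOn (fun x => Real.cos x + m / 2 * x ^ 2) (Set.Icc 0 d) := by
    refine antitoneOn_of_deriv_nonpos (convex_Icc _ _) hcont.continuousOn
      (fun x _ => (hderiv x).differentiableAt.differentiableWithinAt) fun x hx => ?_
    rw [interior_Icc] at hx
    rw [(hderiv x).deriv, hm]
    have := mul_sin_le_mul_sin hx.1.le hx.2.le hdpi
    have : Real.sin d / d * x ≤ Real.sin x := by
      rw [div_mul_eq_mul_div, div_le_iff₀ hd']; linarith
    linarith
  have hmono : MonotoneOn (fun x => Real.cos x + m / 2 * x ^ 2) (Set.Icc d Real.pi) := by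
    refine monotoneOn_of_deriv_nonneg (convex_Icc _ _) hcont.continuousOn
      (fun x _ => (hderiv x).differentiableAt.differentiableWithinAt) fun x hx => ?_
    rw [interior_Icc] at hx
    rw [(hderiv x).deriv, hm]
    have := mul_sin_le_mul_sin hd hx.1.le hx.2.le
    have : Real.sin x ≤ Real.sin d / d * x := by
      rw [div_mul_eq_mul_div, le_div_iff₀ hd']; linarith
    linarith
  refine ⟨m / 2, fun x => ?_⟩
  rw [← Real.cos_abs x, ← sq_abs x]
  have hx := abs_nonneg x
  generalize |x| = y at hx
  rcases le_total y d with hyd | hyd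
  · have := hanti ⟨hx, hyd⟩ ⟨hd, le_rfl⟩ hyd
    simp only at this
    linarith
  rcases le_total y Real.pi with hy | hy
  · have := hmono ⟨le_rfl, hdpi⟩ ⟨hyd, hy⟩ hyd
    simp only at this
    linarith
  · have hpi := hmono ⟨le_rfl, hdpi⟩ ⟨hdpi, le_rfl⟩ hdpi
    simp only [Real.cos_pi] at hpi
    have hsq : m / 2 * Real.pi ^ 2 ≤ m / 2 * y ^ 2 := by gcongr
    linarith [Real.neg_one_le_cos y]


/-- Lemma on spherical vs. tangential distance.
For all `α, β ≥ 0` and `γ ∈ ℝ`,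
`arccos (cos α * cos β + sin α * sin β * cos γ) ≤ √(α² + β² − 2αβ cos γ)`. -/
theorem spherical_le_tangential_distance
    (α β γ : ℝ) (hα : 0 ≤ α) (hβ : 0 ≤ β) :
    Real.arccos (Real.cos α * Real.cos β + Real.sin α * Real.sin β * Real.cos γ) ≤
      Real.sqrt (α ^ 2 + β ^ 2 - 2 * α * β * Real.cos γ) := by
  have hc₁ := Real.neg_one_le_cos γ
  have hc₂ := Real.cos_le_one γ
  generalize Real.cos γ = c at hc₁ hc₂
  have hnn : 0 ≤ α ^ 2 + β ^ 2 - 2 * α * β * c := by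
    nlinarith [mul_nonneg (sub_nonneg.2 hc₂) (mul_nonneg hα hβ), sq_nonneg (α - β)]
  have hsq := Real.sq_sqrt hnn
  have hd := Real.sqrt_nonneg (α ^ 2 + β ^ 2 - 2 * α * β * c)
  generalize √(α ^ 2 + β ^ 2 - 2 * α * β * c) = d at hsq hd
  rcases le_total Real.pi d with hpi | hpi
  · exact (Real.arccos_le_pi _).trans hpi
  obtain ⟨k, hk⟩ := exists_cos_sub_mul_le_cos hd hpi
  have h₁ := mul_le_mul_of_nonneg_left (hk (α - β)) (by linarith : 0 ≤ (1 + c) / 2)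
  have h₂ := mul_le_mul_of_nonneg_left (hk (α + β)) (by linarith : 0 ≤ (1 - c) / 2)
  rw [hsq, Real.cos_sub] at h₁
  rw [hsq, Real.cos_add] at h₂
  rw [← Real.arccos_cos hd hpi]
  apply Real.arccos_le_arccos
  linarith
end

section
/- Let α, β ≥ 0 be real numbers with α + β ≤ π. Then the function f(λ) = cos(√(α² + β² + 2·α·β·λ)) is convex on the interval [−1, 1]. -/
theorem Real.sin_div_self_antitoneOn :
    AntitoneOn (fun x : ℝ => Real.sin x / x) (Set.Ioc 0 Real.pi) := by
  intro x hx y hy hxy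
  have h := strictConcaveOn_sin_Icc.concaveOn.2 (Set.left_mem_Icc.2 Real.pi_pos.le)
    (Set.Ioc_subset_Icc_self hy) (sub_nonneg.2 ((div_le_one hy.1).2 hxy))
    (div_nonneg hx.1.le hy.1.le) (sub_add_cancel _ _)
  simp only [smul_eq_mul, Real.sin_zero, mul_zero, zero_add, div_mul_cancel₀ _ hy.1.ne'] at h
  change Real.sin y / y ≤ Real.sin x / x
  rw [le_div_iff₀ hx.1]
  calc Real.sin y / y * x = x / y * Real.sin y := by ring
    _ ≤ Real.sin x := h

theorem Real.hasDerivAt_cos_sqrt {u : ℝ} (hu : 0 < u) :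
    HasDerivAt (fun u : ℝ => Real.cos (Real.sqrt u))
      (-(Real.sin (Real.sqrt u) / Real.sqrt u) / 2) u := by
  convert (Real.hasDerivAt_sqrt hu.ne').cos using 1
  ring

theorem Real.convexOn_cos_sqrt :
    ConvexOn ℝ (Set.Icc 0 (Real.pi ^ 2)) (fun u : ℝ => Real.cos (Real.sqrt u)) := by
  refine MonotoneOn.convexOn_of_deriv (convex_Icc _ _) (by fun_prop) ?_ ?_
  · rw [interior_Icc]
    exact fun u hu => (Real.hasDerivAt_cos_sqrt hu.1).differentiableAt.differentiableWithinAt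
  · rw [interior_Icc]
    intro u hu v hv huv
    have hmem {w : ℝ} (hw : w ∈ Set.Ioo 0 (Real.pi ^ 2)) :
        Real.sqrt w ∈ Set.Ioc 0 Real.pi :=
      ⟨Real.sqrt_pos.2 hw.1, (Real.sqrt_le_left Real.pi_pos.le).2 hw.2.le⟩
    rw [(Real.hasDerivAt_cos_sqrt hu.1).deriv, (Real.hasDerivAt_cos_sqrt hv.1).deriv]
    have h := Real.sin_div_self_antitoneOn (hmem hu) (hmem hv) (Real.sqrt_le_sqrt huv)
    dsimp only at h
    linarith

/-- For `α, β ≥ 0` with `α + β ≤ π`, the function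
`λ ↦ cos (√(α² + β² + 2αβλ))` is convex on `[−1, 1]`. -/
theorem cos_sqrt_convexOn
    (α β : ℝ) (hα : 0 ≤ α) (hβ : 0 ≤ β) (hαβ : α + β ≤ Real.pi) :
    ConvexOn ℝ (Set.Icc (-1 : ℝ) 1)
      (fun lam : ℝ => Real.cos (Real.sqrt (α ^ 2 + β ^ 2 + 2 * α * β * lam))) := by
  have hmem {x : ℝ} (hx : x ∈ Set.Icc (-1 : ℝ) 1) :
      α ^ 2 + β ^ 2 + 2 * α * β * x ∈ Set.Icc 0 (Real.pi ^ 2) := by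
    have hαβ₀ : 0 ≤ α * β := mul_nonneg hα hβ
    have hsq : (α + β) ^ 2 ≤ Real.pi ^ 2 := pow_le_pow_left₀ (add_nonneg hα hβ) hαβ 2
    constructor
    · nlinarith [sq_nonneg (α - β), mul_le_mul_of_nonneg_left hx.1 hαβ₀]
    · nlinarith [mul_le_mul_of_nonneg_left hx.2 hαβ₀]
  refine ⟨convex_Icc _ _, fun x hx y hy a b ha hb hab => ?_⟩
  convert Real.convexOn_cos_sqrt.2 (hmem hx) (hmem hy) ha hb hab using 2
  simp only [smul_eq_mul]
  linear_combination -(α ^ 2 + β ^ 2) * hab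
end

section
/- Let n ≥ 1 and δ ∈ ℝⁿ with 0 < ‖δ‖ < π, and write (w, v) = exp δ = (cos‖δ‖, (sin‖δ‖/‖δ‖)·δ). Then v ≠ 0 and the sphere logarithm recovers δ: (atan2(‖v‖, w)/‖v‖) · v = δ. In particular, exp is injective on the open ball {δ ∈ ℝⁿ : ‖δ‖ < π}. -/
/-- `sinc t = sin t / t` for `t ≠ 0`, and `sinc 0 = 1`. -/
noncomputable def sinc (t : ℝ) : ℝ := if t = 0 then 1 else Real.sin t / t

/-- `atan2 y x`, the two-argument arctangent, given by `Complex.arg (x + i y)`. -/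
noncomputable def atan2 (y x : ℝ) : ℝ := Complex.arg (x + y * Complex.I)

theorem sinc_pos {t : ℝ} (h0 : 0 ≤ t) (hπ : t < Real.pi) : 0 < sinc t := by
  unfold sinc
  split_ifs with h
  · exact one_pos
  · have ht : 0 < t := lt_of_le_of_ne h0 (Ne.symm h)
    exact div_pos (Real.sin_pos_of_pos_of_lt_pi ht hπ) ht

theorem atan2_sin_cos {t : ℝ} (ht : t ∈ Set.Ioc (-Real.pi) Real.pi) :
    atan2 (Real.sin t) (Real.cos t) = t := by
  simpa [atan2] using Complex.arg_cos_add_sin_mul_I ht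

theorem sphereExp_injOn_ball (E : Type*) [NormedAddCommGroup E] [NormedSpace ℝ E] :
    Set.InjOn (fun δ : E => ((Real.cos ‖δ‖, sinc ‖δ‖ • δ) : ℝ × E)) {δ : E | ‖δ‖ < Real.pi} := by
  intro a ha b hb hab
  obtain ⟨hcos, hsmul⟩ := Prod.ext_iff.mp hab
  have hnorm : ‖a‖ = ‖b‖ := Real.injOn_cos ⟨norm_nonneg a, le_of_lt ha⟩
    ⟨norm_nonneg b, le_of_lt hb⟩ hcos
  simp only [hnorm] at hsmul
  exact smul_right_injective E (sinc_pos (norm_nonneg b) hb).ne' hsmul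

/-- For `0 < ‖δ‖ < π` and `(w, v) = exp δ`, we have `v ≠ 0` and the
sphere logarithm `(atan2 (‖v‖, w) / ‖v‖) • v` recovers `δ`; in particular the sphere
exponential is injective on the open ball of radius `π`. -/
theorem sphereLog_recovers
    {n : ℕ} (hn : 1 ≤ n) (δ : EuclideanSpace ℝ (Fin n))
    (h0 : 0 < ‖δ‖) (hπ : ‖δ‖ < Real.pi)
    (w : ℝ) (v : EuclideanSpace ℝ (Fin n))
    (hw : w = Real.cos ‖δ‖) (hv : v = (Real.sin ‖δ‖ / ‖δ‖) • δ) :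
    v ≠ 0 ∧ (atan2 ‖v‖ w / ‖v‖) • v = δ ∧
      Set.InjOn
        (fun δ' : EuclideanSpace ℝ (Fin n) =>
          ((Real.cos ‖δ'‖, sinc ‖δ'‖ • δ') : ℝ × EuclideanSpace ℝ (Fin n)))
        {δ' : EuclideanSpace ℝ (Fin n) | ‖δ'‖ < Real.pi} := by
  have hsin : 0 < Real.sin ‖δ‖ := Real.sin_pos_of_pos_of_lt_pi h0 hπ
  have hnorm : ‖v‖ = Real.sin ‖δ‖ := by
    rw [hv, norm_smul, Real.norm_of_nonneg (div_pos hsin h0).le, div_mul_cancel₀ _ h0.ne']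
  refine ⟨norm_pos_iff.mp (hnorm ▸ hsin), ?_, sphereExp_injOn_ball _⟩
  rw [hnorm, hw, atan2_sin_cos ⟨by linarith, hπ.le⟩, hv, smul_smul,
    div_mul_div_cancel₀ hsin.ne', div_self h0.ne', one_smul]
end
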